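/- Let T_1,…,T_k be pairwise arc-disjoint arborescences of a finite undirected graph G rooted at destination t, and let c < k. If, for every choice of starting arborescence, the circular-arborescence routing process on the cyclic order ⟨T_1,…,T_{k−1}⟩ is (c−1)-resilient against dynamic failures, then there exists a routing process on G that is c-resilient against dynamic failures (namely: route a packet canonically along T_k until reaching t or hitting a down outgoing arc (x,y) of T_k; in the latter case, if (y,x) ∈ T' for some T' ∈ {T_1,…,T_{k−1}}, run the circular-arborescence routing on ⟨T_1,…,T_{k−1}⟩ starting at x on the arborescence T'). -/

import Mathlib

namespace FRR

open scoped Classical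

variable {V : Type*} [Fintype V] [DecidableEq V]

/-- `G` is `k`-edge-connected: removing any set of at most `k-1` edges keeps it connected. -/
def EdgeConnected (G : SimpleGraph V) (k : ℕ) : Prop :=
  ∀ F : Set (Sym2 V), F ⊆ G.edgeSet → F.ncard ≤ k - 1 → (G.deleteEdges F).Connected

/-- An arborescence of `G` rooted at `t`, given by a parent map: every node `v ≠ t`
has exactly one outgoing arc `(v, par v)`, and iterating the parent map reaches `t`. -/
structure Arb (G : SimpleGraph V) (t : V) where
  par : V → V
  adj : ∀ v, v ≠ t → G.Adj v (par v)
  reaches : ∀ v, ∃ n : ℕ, par^[n] v = t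

/-- The arc `(u, v)` belongs to the arborescence `T`. -/
def Arb.Arc {G : SimpleGraph V} {t : V} (T : Arb G t) (u v : V) : Prop :=
  u ≠ t ∧ T.par u = v

/-- Two arborescences are arc-disjoint: they share no directed arc. -/
def ArcDisjoint {G : SimpleGraph V} {t : V} (T T' : Arb G t) : Prop :=
  ∀ u v : V, ¬ (T.Arc u v ∧ T'.Arc u v)

/-- One step of the circular-arborescence routing process on the cyclic order
`⟨T 0, …, T (m-1)⟩` at time `n`: route canonically along the current arborescence;
if the outgoing arc is down, switch to the first arborescence after the current one
in the cyclic order whose outgoing arc at the current node is up. -/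
noncomputable def circNext {G : SimpleGraph V} {t : V} {m : ℕ}
    (T : Fin m → Arb G t) (σ : ℕ → Set (Sym2 V)) (n : ℕ)
    (v : V) (i : Fin m) : V × Fin m :=
  if v = t then (v, i)
  else if s(v, (T i).par v) ∉ σ n then ((T i).par v, i)
  else if h : ∃ d : ℕ, d < m ∧
      s(v, (T ⟨((i : ℕ) + 1 + d) % m, Nat.mod_lt _ i.pos⟩).par v) ∉ σ n then
    let j : Fin m := ⟨((i : ℕ) + 1 + Nat.find h) % m, Nat.mod_lt _ i.pos⟩
    ((T j).par v, j)
  else (v, i)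

/-- The trajectory of the circular-arborescence routing process started at node `s`
on arborescence `i₀`, under the failure schedule `σ`. -/
noncomputable def circTraj {G : SimpleGraph V} {t : V} {m : ℕ}
    (T : Fin m → Arb G t) (σ : ℕ → Set (Sym2 V)) (s : V) (i₀ : Fin m) :
    ℕ → V × Fin m
  | 0 => (s, i₀)
  | n + 1 => circNext T σ n (circTraj T σ s i₀ n).1 (circTraj T σ s i₀ n).2

/-- The circular-arborescence routing process on `T` is `r`-resilient against dynamic
failures: for every unstable-link set `F` with `|F| ≤ r`, every (dynamic, i.e. arbitrary)
failure schedule `σ` on `F`, every starting node `s` and starting arborescence `i₀`,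
if the trajectory satisfies the non-trap assumption and `s` is connected to `t`
in `G ∖ F`, then the packet reaches `t` after finitely many steps. -/
def CircResilient {G : SimpleGraph V} (t : V) {m : ℕ} (T : Fin m → Arb G t)
    (r : ℕ) : Prop :=
  ∀ F : Set (Sym2 V), F ⊆ G.edgeSet → F.ncard ≤ r →
    ∀ σ : ℕ → Set (Sym2 V), (∀ n, σ n ⊆ F) →
      ∀ (s : V) (i₀ : Fin m),
        (∀ n, (G.deleteEdges F).Reachable (circTraj T σ s i₀ n).1
            (circTraj T σ s i₀ (n + 1)).1) →
        (G.deleteEdges F).Reachable s t →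
        ∃ n, (circTraj T σ s i₀ n).1 = t

/-- A (basic, deterministic) forwarding scheme on `G`: given the current node, the
in-port (the neighbor the packet arrived from, `none` for a freshly originated packet)
and the set of currently active neighbors, it selects an active neighbor to forward to. -/
structure FwdScheme (G : SimpleGraph V) where
  fwd : V → Option V → Set V → V
  mem : ∀ (v : V) (ip : Option V) (A : Set V), A.Nonempty → fwd v ip A ∈ A

/-- The packet trajectory (current node, in-port) of a forwarding scheme with
destination `t`, started at `s`, under the failure schedule `σ`; the packet is
absorbed at `t` and gets stuck when no incident link is active. -/
noncomputable def FwdScheme.traj {G : SimpleGraph V} (P : FwdScheme G)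
    (σ : ℕ → Set (Sym2 V)) (t s : V) : ℕ → V × Option V
  | 0 => (s, none)
  | n + 1 =>
    let p := FwdScheme.traj P σ t s n
    if p.1 = t then p
    else if ({u : V | G.Adj p.1 u ∧ s(p.1, u) ∉ σ n} : Set V).Nonempty then
      (P.fwd p.1 p.2 {u : V | G.Adj p.1 u ∧ s(p.1, u) ∉ σ n}, some p.1)
    else p

/-- A forwarding scheme for destination `t` is `r`-resilient against dynamic failures:
for every unstable-link set `F` with `|F| ≤ r`, every (dynamic, i.e. arbitrary) failure
schedule `σ` on `F` whose induced trajectory satisfies the non-trap assumption, and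
every source `s` connected to `t` in `G ∖ F`, the packet reaches `t` in finitely
many steps. -/
def DynResilient {G : SimpleGraph V} (P : FwdScheme G) (t : V) (r : ℕ) : Prop :=
  ∀ F : Set (Sym2 V), F ⊆ G.edgeSet → F.ncard ≤ r →
    ∀ σ : ℕ → Set (Sym2 V), (∀ n, σ n ⊆ F) →
      ∀ s : V,
        (∀ n, (G.deleteEdges F).Reachable (P.traj σ t s n).1 (P.traj σ t s (n + 1)).1) →
        (G.deleteEdges F).Reachable s t →
        ∃ n, (P.traj σ t s n).1 = t

/-- Abstract form of `circNext`: `g j` says that the outgoing arc of `v` in `T j` is up. -/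
noncomputable def circAux {G : SimpleGraph V} {t : V} {m : ℕ}
    (T : Fin m → Arb G t) (g : Fin m → Prop) (v : V) (i : Fin m) : V × Fin m :=
  if g i then ((T i).par v, i)
  else if h : ∃ d : ℕ, d < m ∧ g ⟨((i : ℕ) + 1 + d) % m, Nat.mod_lt _ i.pos⟩ then
    ((T ⟨((i : ℕ) + 1 + Nat.find h) % m, Nat.mod_lt _ i.pos⟩).par v,
      ⟨((i : ℕ) + 1 + Nat.find h) % m, Nat.mod_lt _ i.pos⟩)
  else (v, i)

lemma circNext_eq {G : SimpleGraph V} {t : V} {m : ℕ}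
    (T : Fin m → Arb G t) (σ : ℕ → Set (Sym2 V)) (n : ℕ) (v : V) (i : Fin m) (hv : v ≠ t) :
    circNext T σ n v i = circAux T (fun j => s(v, (T j).par v) ∉ σ n) v i := by
  unfold circNext circAux
  rw [if_neg hv]
  congr 2
  funext h
  dsimp only
  congr

lemma exists_shift {m : ℕ} (i j : Fin m) :
    ∃ d : ℕ, d < m ∧ (⟨((i : ℕ) + 1 + d) % m, Nat.mod_lt _ i.pos⟩ : Fin m) = j := by
  have hi := i.2
  have hj := j.2
  by_cases h : (i : ℕ) + 1 ≤ j
  · refine ⟨j - (i + 1), by omega, Fin.ext ?_⟩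
    have : (i : ℕ) + 1 + (j - (i + 1)) = j := by omega
    simp only [this]
    exact Nat.mod_eq_of_lt hj
  · refine ⟨j + m - (i + 1), by omega, Fin.ext ?_⟩
    have : (i : ℕ) + 1 + (j + m - (i + 1)) = j + m := by omega
    simp only [this, Nat.add_mod_right]
    exact Nat.mod_eq_of_lt hj

lemma circAux_up {G : SimpleGraph V} {t : V} {m : ℕ}
    (T : Fin m → Arb G t) (g : Fin m → Prop) (v : V) (i : Fin m) (hg : ∃ j, g j) :
    ∃ j, g j ∧ circAux T g v i = ((T j).par v, j) := by
  unfold circAux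
  by_cases hi : g i
  · exact ⟨i, hi, by rw [if_pos hi]⟩
  · rw [if_neg hi]
    have h : ∃ d : ℕ, d < m ∧ g ⟨((i : ℕ) + 1 + d) % m, Nat.mod_lt _ i.pos⟩ := by
      obtain ⟨j, hj⟩ := hg
      obtain ⟨d, hd, e⟩ := exists_shift i j
      exact ⟨d, hd, by rw [e]; exact hj⟩
    rw [dif_pos h]
    exact ⟨_, (Nat.find_spec h).2, rfl⟩

lemma circAux_mono {G : SimpleGraph V} {t : V} {m : ℕ}
    (T : Fin m → Arb G t) (g g' : Fin m → Prop) (v : V) (i j₀ : Fin m)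
    (h1 : ∀ j, g j → g' j) (h2 : ∀ j, j ≠ j₀ → g' j → g j) (hg : ∃ j, g' j) :
    (∃ j, g j ∧ circAux T g v i = ((T j).par v, j) ∧ circAux T g' v i = ((T j).par v, j)) ∨
      circAux T g' v i = ((T j₀).par v, j₀) := by
  obtain ⟨j, hj, e⟩ := circAux_up T g' v i hg
  by_cases hjj : j = j₀
  · right; rw [e, hjj]
  left
  have gj := h2 j hjj hj
  refine ⟨j, gj, ?_, e⟩
  unfold circAux at e ⊢
  by_cases hi : g i
  · rw [if_pos (h1 i hi)] at e
    rw [if_pos hi, e]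
  by_cases hi' : g' i
  · rw [if_pos hi'] at e
    have : i = j := congrArg Prod.snd e
    exact absurd (this ▸ gj) hi
  rw [if_neg hi'] at e
  rw [if_neg hi]
  have mk : ∀ q : Fin m → Prop, q j →
      ∃ d : ℕ, d < m ∧ q ⟨((i : ℕ) + 1 + d) % m, Nat.mod_lt _ i.pos⟩ := by
    intro q hq
    obtain ⟨d, hd, e⟩ := exists_shift i j
    exact ⟨d, hd, by rw [e]; exact hq⟩
  have h := mk g gj
  have h' := mk g' hj
  rw [dif_pos h'] at e
  rw [dif_pos h]
  have ej := congrArg Prod.snd e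
  simp only at ej
  have : Nat.find h = Nat.find h' := by
    rw [Nat.find_eq_iff]
    refine ⟨⟨(Nat.find_spec h').1, by rw [ej]; exact gj⟩, ?_⟩
    intro d hd hc
    exact Nat.find_min h' hd ⟨hc.1, h1 _ hc.2⟩
  have fe : (⟨((i : ℕ) + 1 + Nat.find h) % m, Nat.mod_lt _ i.pos⟩ : Fin m) = j := by
    rw [← ej]
    exact Fin.ext (by simp only [this])
  rw [fe]

/-- Index of the circular arborescence containing the arc on which the packet arrived. -/
noncomputable def curIdx {G : SimpleGraph V} {t : V} {m : ℕ}
    (T : Fin m → Arb G t) (v : V) : Option V → Option (Fin m)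
  | none => none
  | some u => if h : ∃ i, (T i).Arc u v then some h.choose else none

/-- Starting arborescence of the circular routing after the arc of `K` at `v` is down. -/
noncomputable def startIdx {G : SimpleGraph V} {t : V} {m : ℕ}
    (T : Fin m → Arb G t) (K : Arb G t) (v : V) : Option (Fin m) :=
  if h : ∃ i, (T i).Arc (K.par v) v then some h.choose
  else if h : 0 < m then some ⟨0, h⟩ else none

/-- Intended next hop of the combined routing process. -/
noncomputable def want {G : SimpleGraph V} {t : V} {m : ℕ}
    (T : Fin m → Arb G t) (K : Arb G t) (v : V) (ip : Option V) (A : Set V) : V :=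
  match curIdx T v ip with
  | some i => (circAux T (fun j => (T j).par v ∈ A) v i).1
  | none => if K.par v ∈ A then K.par v else
    match startIdx T K v with
    | some i => (circAux T (fun j => (T j).par v ∈ A) v i).1
    | none => v

/-- The combined forwarding scheme. -/
noncomputable def scheme {G : SimpleGraph V} {t : V} {m : ℕ}
    (T : Fin m → Arb G t) (K : Arb G t) : FwdScheme G where
  fwd v ip A := if want T K v ip A ∈ A then want T K v ip A
    else if h : A.Nonempty then h.some else v
  mem v ip A hA := by
    by_cases h : want T K v ip A ∈ A
    · rw [if_pos h]; exact h
    · rw [if_neg h, dif_pos hA]; exact hA.some_mem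

/-- The active neighbours of `v`. -/
def act (G : SimpleGraph V) (S : Set (Sym2 V)) (v : V) : Set V := {u : V | G.Adj v u ∧ s(v, u) ∉ S}

lemma scheme_step {G : SimpleGraph V} {t : V} {m : ℕ}
    (T : Fin m → Arb G t) (K : Arb G t) (σ : ℕ → Set (Sym2 V)) (s : V) (n : ℕ)
    (v : V) (ip : Option V) (hp : (scheme T K).traj σ t s n = (v, ip)) (hv : v ≠ t)
    (hw : want T K v ip (act G (σ n) v) ∈ act G (σ n) v) :
    (scheme T K).traj σ t s (n + 1) = (want T K v ip (act G (σ n) v), some v) := by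
  have hne : (act G (σ n) v).Nonempty := ⟨_, hw⟩
  rw [FwdScheme.traj]
  simp only [hp]
  rw [if_neg hv, if_pos (show ({u : V | G.Adj v u ∧ s(v, u) ∉ σ n} : Set V).Nonempty from hne)]
  congr 1
  exact if_pos hw

/-- A return of the circular process to its initial state contradicts resilience. -/
lemma no_loop {G : SimpleGraph V} {t : V} {m r : ℕ} (T : Fin m → Arb G t)
    (hcirc : CircResilient t T r) (F : Set (Sym2 V)) (hF : F ⊆ G.edgeSet) (hr : F.ncard ≤ r)
    (σ : ℕ → Set (Sym2 V)) (hσ : ∀ n, σ n ⊆ F) (x : V) (i : Fin m)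
    (hx : (G.deleteEdges F).Reachable x t) (L : ℕ)
    (hL : circTraj T σ x i (L + 1) = (x, i))
    (hreach : ∀ n ≤ L, (G.deleteEdges F).Reachable (circTraj T σ x i n).1
      (circTraj T σ x i (n + 1)).1)
    (ht : ∀ n ≤ L, (circTraj T σ x i n).1 ≠ t) : False := by
  set ρ : ℕ → Set (Sym2 V) := fun n => σ (n % (L + 1)) with hρ
  have key : ∀ n, circTraj T ρ x i n = circTraj T σ x i (n % (L + 1)) := by
    intro n
    induction n with
    | zero => simp [circTraj]
    | succ n ih =>
      have step : circTraj T ρ x i (n + 1) = circTraj T σ x i (n % (L + 1) + 1) := by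
        rw [circTraj, circTraj, ih]
        rfl
      rw [step]
      have hlt : n % (L + 1) < L + 1 := Nat.mod_lt _ (by omega)
      by_cases h : n % (L + 1) = L
      · have : (n + 1) % (L + 1) = 0 := by
          rw [Nat.add_mod, h]
          rcases Nat.eq_zero_or_pos L with h0 | h0
          · subst h0; simp
          · rw [Nat.mod_eq_of_lt (show 1 < L + 1 by omega), Nat.mod_self]
        rw [this, h, hL]; rfl
      · have : (n + 1) % (L + 1) = n % (L + 1) + 1 := by
          rw [Nat.add_mod]
          rw [Nat.mod_eq_of_lt (show 1 < L + 1 by omega), Nat.mod_eq_of_lt (by omega)]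
        rw [this]
  have step' : ∀ n, circTraj T ρ x i (n + 1) = circTraj T σ x i (n % (L + 1) + 1) := by
    intro n
    rw [circTraj, circTraj, key]
    rfl
  obtain ⟨n, hn⟩ := hcirc F hF hr ρ (fun n => hσ _) x i (by
    intro n
    rw [step', key]
    exact hreach _ (Nat.lt_succ_iff.mp (Nat.mod_lt _ (by omega)))) hx
  rw [key] at hn
  exact ht _ (Nat.lt_succ_iff.mp (Nat.mod_lt _ (by omega))) hn

lemma exists_up {G : SimpleGraph V} {t : V} {m : ℕ} (T : Fin m → Arb G t)
    (hT : ∀ i j, i ≠ j → ArcDisjoint (T i) (T j)) (S : Set (Sym2 V)) (hS : S.ncard < m)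
    (v : V) (hv : v ≠ t) : ∃ j, s(v, (T j).par v) ∉ S := by
  by_contra hcon
  push Not at hcon
  have hinj : Function.Injective (fun j : Fin m => s(v, (T j).par v)) := by
    intro a b hab
    by_contra hne
    have : (T a).par v = (T b).par v := Sym2.congr_right.mp hab
    exact hT a b hne v _ ⟨⟨hv, this⟩, ⟨hv, rfl⟩⟩
  have h1 : (Set.range (fun j : Fin m => s(v, (T j).par v))).ncard ≤ S.ncard :=
    Set.ncard_le_ncard (by rintro _ ⟨j, rfl⟩; exact hcon j) (Set.toFinite _)
  rw [← Set.image_univ, Set.ncard_image_of_injective _ hinj, Set.ncard_univ, Nat.card_fin] at h1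
  omega

lemma curIdx_arc {G : SimpleGraph V} {t : V} {m : ℕ} (T : Fin m → Arb G t)
    (hT : ∀ i j, i ≠ j → ArcDisjoint (T i) (T j)) (v : V) (hv : v ≠ t) (j : Fin m) :
    curIdx T ((T j).par v) (some v) = some j := by
  have h : ∃ i, (T i).Arc v ((T j).par v) := ⟨j, hv, rfl⟩
  unfold curIdx
  dsimp only
  rw [dif_pos h]
  congr 1
  by_contra hne
  exact hT _ _ hne v _ ⟨h.choose_spec, ⟨hv, rfl⟩⟩

lemma general {G : SimpleGraph V} {t : V} {m c : ℕ} (hcm : c ≤ m) (T : Fin m → Arb G t)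
    (K : Arb G t) (hT : ∀ i j, i ≠ j → ArcDisjoint (T i) (T j))
    (hK : ∀ i, ArcDisjoint (T i) K) (hcirc : CircResilient t T (c - 1)) :
    DynResilient (scheme T K) t c := by
  intro F hF hFc σ hσ s hreach hst
  by_contra hnt
  push Not at hnt
  set R := (scheme T K).traj σ t s with hR
  -- phase one
  obtain ⟨n₀, hcur, hdown⟩ : ∃ n, curIdx T (R n).1 (R n).2 = none ∧
      s((R n).1, K.par (R n).1) ∈ σ n := by
    by_contra hcon
    push Not at hcon
    have key : ∀ n, (R n).1 = K.par^[n] s ∧ curIdx T (R n).1 (R n).2 = none := by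
      intro n
      induction n with
      | zero => exact ⟨rfl, rfl⟩
      | succ n ih =>
        have hv := hnt n
        have hup := hcon n ih.2
        have hmem : K.par (R n).1 ∈ act G (σ n) (R n).1 := ⟨K.adj _ hv, hup⟩
        have hw : want T K (R n).1 (R n).2 (act G (σ n) (R n).1) = K.par (R n).1 := by
          unfold want
          rw [ih.2]
          simp only
          rw [if_pos hmem]
        have := scheme_step T K σ s n (R n).1 (R n).2 rfl hv (by rw [hw]; exact hmem)
        rw [hw] at this
        rw [hR, this]
        refine ⟨?_, ?_⟩
        · rw [Function.iterate_succ_apply', ih.1]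
        · simp only
          unfold curIdx
          dsimp only
          rw [dif_neg]
          rintro ⟨i, hi⟩
          exact hK i _ _ ⟨hi, ⟨hv, rfl⟩⟩
    obtain ⟨n, hn⟩ := K.reaches s
    exact hnt n ((key n).1.trans hn)
  -- phase two
  obtain ⟨x, hx⟩ : ∃ x, x = (R n₀).1 := ⟨_, rfl⟩
  obtain ⟨y, hy⟩ : ∃ y, y = K.par x := ⟨_, rfl⟩
  rw [← hx, ← hy] at hdown
  rw [← hx] at hcur
  have hxt : x ≠ t := hx ▸ hnt n₀
  have heF : s(x, y) ∈ F := hσ _ hdown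
  have hF'c : (F \ {s(x, y)}).ncard + 1 = F.ncard :=
    Set.ncard_sdiff_singleton_add_one heF (Set.toFinite _)
  have hm : 0 < m := by omega
  obtain ⟨i₁, hi₁, hi₁u⟩ : ∃ i₁, startIdx T K x = some i₁ ∧
      ∀ j, (T j).Arc y x → j = i₁ := by
    unfold startIdx
    rw [← hy]
    by_cases h : ∃ i, (T i).Arc y x
    · rw [dif_pos h]
      refine ⟨_, rfl, ?_⟩
      intro j hj
      by_contra hne
      exact hT _ _ hne _ _ ⟨hj, h.choose_spec⟩
    · rw [dif_neg h, dif_pos hm]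
      exact ⟨_, rfl, fun j hj => absurd ⟨j, hj⟩ h⟩
  set F' := F \ {s(x, y)} with hF'
  set τ : ℕ → Set (Sym2 V) := fun n => σ (n₀ + n) \ {s(x, y)} with hτ
  have hτF : ∀ n, τ n ⊆ F' := fun n => Set.sdiff_subset_sdiff_left (hσ _)
  have hle : G.deleteEdges F ≤ G.deleteEdges F' :=
    SimpleGraph.deleteEdges_anti Set.sdiff_subset
  have hxreach : (G.deleteEdges F').Reachable x t := by
    have : ∀ n, (G.deleteEdges F).Reachable (R n).1 t := by
      intro n
      induction n with
      | zero => exact hst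
      | succ n ih => exact (hreach n).symm.trans ih
    rw [hx]
    exact (this n₀).mono hle
  have hr : F'.ncard ≤ c - 1 := by omega
  have hF'G : F' ⊆ G.edgeSet := Set.sdiff_subset.trans hF
  set S := circTraj T τ x i₁ with hS
  have hS0 : S 0 = (x, i₁) := rfl
  have inv : ∀ n, (∀ l ≤ n, (R (n₀ + l)).1 = (S l).1) ∧
      want T K (R (n₀ + n)).1 (R (n₀ + n)).2 (act G (σ (n₀ + n)) (R (n₀ + n)).1) =
        (circAux T (fun j => (T j).par (R (n₀ + n)).1 ∈ act G (σ (n₀ + n)) (R (n₀ + n)).1)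
          (R (n₀ + n)).1 (S n).2).1 := by
    intro n
    induction n with
    | zero =>
      refine ⟨?_, ?_⟩
      · intro l hl
        obtain rfl : l = 0 := by omega
        rw [hS0]; exact hx.symm
      · rw [hS0, Nat.add_zero, ← hx]
        conv_lhs => unfold want
        rw [hcur]
        simp only
        rw [← hy, if_neg (fun h => h.2 hdown), hi₁]
    | succ n ih =>
      obtain ⟨ih1, ih2⟩ := ih
      have hSt : ∀ l ≤ n, (S l).1 ≠ t := fun l hl => ih1 l hl ▸ hnt _
      obtain ⟨v, hv⟩ : ∃ v, v = (R (n₀ + n)).1 := ⟨_, rfl⟩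
      have hvt : v ≠ t := hv ▸ hnt _
      have hvS : (S n).1 = v := by rw [hv, ih1 n le_rfl]
      rw [← hv] at ih2
      have hSn : S (n + 1) = circAux T (fun j => s(v, (T j).par v) ∉ τ n) v (S n).2 := by
        rw [← circNext_eq T τ n v _ hvt, ← hvS]; rfl
      have hex : ∃ j, s(v, (T j).par v) ∉ τ n :=
        exists_up T hT _ (lt_of_le_of_lt (Set.ncard_le_ncard (hτF n) (Set.toFinite _))
          (by omega)) v hvt
      have hact : (fun j => (T j).par v ∈ act G (σ (n₀ + n)) v) =
          fun j => s(v, (T j).par v) ∉ σ (n₀ + n) := by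
        funext j
        exact propext ⟨fun h => h.2, fun h => ⟨(T j).adj v hvt, h⟩⟩
      rw [hact] at ih2
      have hgood : ∃ j, s(v, (T j).par v) ∉ σ (n₀ + n) ∧
          circAux T (fun j => s(v, (T j).par v) ∉ σ (n₀ + n)) v (S n).2 = ((T j).par v, j) ∧
          S (n + 1) = ((T j).par v, j) := by
        by_cases he : ∃ j, s(v, (T j).par v) = s(x, y)
        · obtain ⟨j, hj⟩ := he
          have hvy : v = y ∧ (T j).par v = x := by
            rcases Sym2.eq_iff.mp hj with ⟨h1, h2⟩ | h
            · exact absurd ⟨⟨hxt, h1 ▸ h2⟩, ⟨hxt, hy.symm⟩⟩ (hK j x y)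
            · exact h
          have huniq : ∀ j', s(v, (T j').par v) = s(x, y) → j' = i₁ := by
            intro j' hj'
            rcases Sym2.eq_iff.mp hj' with ⟨h1, h2⟩ | h
            · exact absurd ⟨⟨hxt, h1 ▸ h2⟩, ⟨hxt, hy.symm⟩⟩ (hK j' x y)
            · exact hi₁u j' ⟨hvy.1 ▸ hvt, hvy.1 ▸ h.2⟩
          have hji := huniq j hj
          rcases circAux_mono T (fun j => s(v, (T j).par v) ∉ σ (n₀ + n))
            (fun j => s(v, (T j).par v) ∉ τ n) v (S n).2 i₁
            (fun j h h' => h h'.1)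
            (fun j' hne h h' => h ⟨h', fun h'' => hne (huniq j' h'')⟩) hex with h | h
          · rw [← hSn] at h
            exact h
          · exfalso
            rw [← hSn, ← hji, hvy.2, hji] at h
            refine no_loop T hcirc F' hF'G hr τ hτF x i₁ hxreach n h ?_ hSt
            intro l hl
            rcases Nat.lt_or_ge l n with hln | hln
            · have := hreach (n₀ + l)
              rw [show n₀ + l + 1 = n₀ + (l + 1) by omega, ih1 l hl, ih1 (l + 1) hln] at this
              exact this.mono hle
            · obtain rfl : l = n := by omega
              change (G.deleteEdges F').Reachable (S l).1 (S (l + 1)).1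
              rw [h, hvS, hvy.1]
              apply SimpleGraph.Adj.reachable
              rw [SimpleGraph.deleteEdges_adj]
              refine ⟨?_, ?_⟩
              · rw [hy]; exact (K.adj x hxt).symm
              · intro h'
                exact h'.2 (Sym2.eq_swap)
        · push Not at he
          have heq : (fun j => s(v, (T j).par v) ∉ τ n) =
              fun j => s(v, (T j).par v) ∉ σ (n₀ + n) := by
            funext j
            refine propext ⟨fun h h' => h ⟨h', he j⟩, fun h h' => h h'.1⟩
          rw [hSn, heq]
          have hex' : ∃ j, s(v, (T j).par v) ∉ σ (n₀ + n) := by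
            obtain ⟨j, hj⟩ := hex
            exact ⟨j, congrFun heq j ▸ hj⟩
          obtain ⟨j, h1, h2⟩ := circAux_up T (fun j => s(v, (T j).par v) ∉ σ (n₀ + n)) v
            (S n).2 hex'
          exact ⟨j, h1, h2, h2⟩
      obtain ⟨j, hj, hc, hs⟩ := hgood
      rw [hc] at ih2
      simp only at ih2
      have hstep := scheme_step T K σ s (n₀ + n) v (R (n₀ + n)).2 (by rw [hv]) hvt
        (by rw [ih2]; exact ⟨(T j).adj v hvt, hj⟩)
      rw [ih2] at hstep
      have hRn : R (n₀ + (n + 1)) = ((T j).par v, some v) := hstep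
      refine ⟨?_, ?_⟩
      · intro l hl
        rcases Nat.lt_or_ge l (n + 1) with h | h
        · exact ih1 l (by omega)
        · obtain rfl : l = n + 1 := by omega
          rw [hRn, hs]
      · rw [hRn, hs]
        simp only
        conv_lhs => unfold want
        rw [curIdx_arc T hT v hvt j]
  obtain ⟨n, hn⟩ := hcirc F' hF'G hr τ hτF x i₁ (by
    intro n
    have := hreach (n₀ + n)
    rw [show n₀ + n + 1 = n₀ + (n + 1) by omega, (inv n).1 n le_rfl,
      (inv (n + 1)).1 (n + 1) le_rfl] at this
    exact this.mono hle) hxreach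
  exact hnt (n₀ + n) (((inv n).1 n le_rfl).trans hn)

/-- Lemma (extension): given `k` pairwise arc-disjoint arborescences of `G` rooted
at `t`, if the circular-arborescence routing on the first `k-1` arborescences (for
every choice of starting arborescence) is `(c-1)`-resilient against dynamic failures,
where `c < k`, then there exists a routing process on `G` that is `c`-resilient
against dynamic failures. -/
theorem extension_lemma
    (G : SimpleGraph V) (t : V) (k c : ℕ) (hck : c < k)
    (T : Fin k → Arb G t)
    (hdisj : ∀ i j : Fin k, i ≠ j → ArcDisjoint (T i) (T j))
    (hcirc : CircResilient t
      (fun i : Fin (k - 1) => T (Fin.castLE (Nat.sub_le k 1) i)) (c - 1)) :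
    ∃ P : FwdScheme G, DynResilient P t c := by
  obtain ⟨m, rfl⟩ : ∃ m, k = m + 1 := ⟨k - 1, by omega⟩
  refine ⟨_, general (m := m) (by omega)
    (fun i : Fin m => T (Fin.castLE (Nat.sub_le (m + 1) 1) i)) (T (Fin.last m)) ?_ ?_ hcirc⟩
  · intro i j hij
    apply hdisj
    intro h
    exact hij (Fin.ext (by simpa using congrArg Fin.val h))
  · intro i
    apply hdisj
    intro h
    have := congrArg Fin.val h
    have h2 := i.2
    simp at this
    omega

end FRR
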